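/- Let λ ∈ ℂ with Re λ > 0, let k ∈ ℤ^d with k ≠ 0, and let G be a Schwartz function on ℝ^d with Fourier transform 𝓕G(ξ) = ∫_{ℝ^d} G(v) e^{−i ξ·v} dv. Then the linearized Vlasov–Poisson kernel satisfies K_G(λ,k) := −(i/|k|²) ∫_{ℝ^d} (k·∇G(v))/(λ + i k·v) dv = ∫_0^∞ e^{−λ s} s (𝓕G)(k s) ds, both integrals converging absolutely. -/

import Mathlib

open MeasureTheory Filter Topology SchwartzMap

section Helpers

variable {d : ℕ}

lemma aux_norm (lam : ℂ) (x s : ℝ) :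
    ‖Complex.exp (-(lam + Complex.I * x) * s)‖ = Real.exp (-lam.re * s) := by
  rw [Complex.norm_exp]
  congr 1
  simp

lemma aux_D_integrable (G : SchwartzMap (Fin d → ℝ) ℝ) (w : Fin d → ℝ) :
    Integrable (fun v : Fin d → ℝ => ((fderiv ℝ (G : (Fin d → ℝ) → ℝ) v w : ℝ) : ℂ)) := by
  have h : Integrable (fun v => (SchwartzMap.evalCLM ℝ (Fin d → ℝ) ℝ w
      (SchwartzMap.fderivCLM ℝ (Fin d → ℝ) ℝ G)) v) := SchwartzMap.integrable _
  exact h.ofReal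

lemma aux_F_integrable (lam : ℂ) (hlam : 0 < lam.re) (L : (Fin d → ℝ) →L[ℝ] ℝ)
    (D : (Fin d → ℝ) → ℂ) (hD : Integrable D) :
    Integrable (Function.uncurry fun (v : Fin d → ℝ) (s : ℝ) =>
        D v * Complex.exp (-(lam + Complex.I * L v) * s))
      (volume.prod (volume.restrict (Set.Ioi (0 : ℝ)))) := by
  have h1 : IntegrableOn (fun s : ℝ => ((Real.exp (-lam.re * s) : ℝ) : ℂ)) (Set.Ioi 0) :=
    (integrableOn_exp_mul_Ioi (by linarith) 0).ofReal
  refine (hD.mul_prod h1).mono ?_ ?_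
  · refine AEStronglyMeasurable.mul hD.aestronglyMeasurable.comp_fst ?_
    apply Continuous.aestronglyMeasurable
    fun_prop
  · refine Eventually.of_forall fun z => le_of_eq ?_
    simp only [Function.uncurry, norm_mul]
    rw [aux_norm, Complex.norm_real, Real.norm_eq_abs, Real.abs_exp]

lemma aux_ibp (G : SchwartzMap (Fin d → ℝ) ℝ) (w : Fin d → ℝ) (L : (Fin d → ℝ) →L[ℝ] ℝ)
    (s : ℝ) :
    ∫ v, ((fderiv ℝ (G : (Fin d → ℝ) → ℝ) v w : ℝ) : ℂ) * Complex.exp (-(Complex.I * (s * L v)))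
      = Complex.I * s * L w * ∫ v, (G v : ℂ) * Complex.exp (-(Complex.I * (s * L v))) := by
  have hn : ∀ v, ‖Complex.exp (-(Complex.I * (s * L v)))‖ = 1 := by
    intro v
    rw [Complex.norm_exp]
    simp
  have hc : Continuous fun v => Complex.exp (-(Complex.I * (s * L v))) := by fun_prop
  have hG : Integrable (fun v => (G v : ℂ)) := G.integrable.ofReal
  have hmul : ∀ f : (Fin d → ℝ) → ℂ, Integrable f →
      Integrable (fun v => f v * Complex.exp (-(Complex.I * (s * L v)))) := fun f hf =>
    hf.mul_bdd (c := 1) hc.aestronglyMeasurable (Eventually.of_forall fun v => (hn v).le)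
  have hgd : ∀ v, HasLineDerivAt ℝ (fun v => Complex.exp (-(Complex.I * (s * L v))))
      (Complex.exp (-(Complex.I * (s * L v))) * (-(Complex.I * (s * L w)))) v w := by
    intro v
    have h0 : HasFDerivAt (fun v => ((L v : ℝ) : ℂ)) (Complex.ofRealCLM.comp L) v :=
      (Complex.ofRealCLM.comp L).hasFDerivAt
    have := (((h0.const_mul (s : ℂ)).const_mul Complex.I).neg.cexp).hasLineDerivAt w
    exact this
  have hfd : ∀ v, HasLineDerivAt ℝ (fun v => (G v : ℂ))
      ((fderiv ℝ (G : (Fin d → ℝ) → ℝ) v w : ℝ) : ℂ) v w := by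
    intro v
    have h0 : HasFDerivAt (fun v => ((G v : ℝ) : ℂ)) (Complex.ofRealCLM.comp (fderiv ℝ G v)) v :=
      Complex.ofRealCLM.hasFDerivAt.comp v (G.differentiableAt.hasFDerivAt)
    exact h0.hasLineDerivAt w
  have key := integral_bilinear_hasLineDerivAt_right_eq_neg_left_of_integrable
    (μ := volume) (B := ContinuousLinearMap.mul ℝ ℂ) (v := w)
    (f := fun v => (G v : ℂ)) (g := fun v => Complex.exp (-(Complex.I * (s * L v))))
    (f' := fun v => ((fderiv ℝ (G : (Fin d → ℝ) → ℝ) v w : ℝ) : ℂ))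
    (g' := fun v => Complex.exp (-(Complex.I * (s * L v))) * (-(Complex.I * (s * L w))))
    (hmul _ (aux_D_integrable G w))
    (by simpa [mul_assoc] using (hmul _ hG).mul_const (-(Complex.I * (s * L w))))
    (hmul _ hG) (fun v _ => hfd v) (fun v _ => hgd v)
  simp only [ContinuousLinearMap.mul_apply', ← mul_assoc] at key
  rw [← neg_eq_iff_eq_neg] at key
  simp only [mul_assoc] at key ⊢
  rw [← key]
  simp only [← mul_assoc]
  rw [integral_mul_const]
  ring

end Helpers

/-- for `Re λ > 0`, `k ∈ ℤ^d ∖ {0}` and `G` Schwartz, the linearized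
Vlasov–Poisson kernel satisfies
`K_G(λ,k) = −(i/|k|²) ∫ (k·∇G(v))/(λ + i k·v) dv = ∫_0^∞ e^{−λ s} s (𝓕G)(k s) ds`,
both integrals converging absolutely. -/
theorem stmt_17 (d : ℕ) (hd : 1 ≤ d) (lam : ℂ) (hlam : 0 < lam.re)
    (k : Fin d → ℤ) (hk : k ≠ 0)
    (G : SchwartzMap (Fin d → ℝ) ℝ) :
    Integrable (fun v : Fin d → ℝ =>
      ((fderiv ℝ (G : (Fin d → ℝ) → ℝ) v (fun i => (k i : ℝ)) : ℝ) : ℂ)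
        / (lam + Complex.I * ∑ i, (k i : ℂ) * (v i : ℂ))) ∧
    IntegrableOn (fun s : ℝ => Complex.exp (-lam * s) * (s : ℂ) *
        ∫ v : Fin d → ℝ, ((G v : ℝ) : ℂ)
          * Complex.exp (-(Complex.I * ∑ i, ((s * (k i : ℝ) : ℝ) : ℂ) * (v i : ℂ))))
      (Set.Ioi 0) ∧
    -(Complex.I / ((∑ i, ((k i : ℝ)) ^ 2 : ℝ) : ℂ))
        * (∫ v : Fin d → ℝ, ((fderiv ℝ (G : (Fin d → ℝ) → ℝ) v (fun i => (k i : ℝ)) : ℝ) : ℂ)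
            / (lam + Complex.I * ∑ i, (k i : ℂ) * (v i : ℂ)))
      = ∫ s in Set.Ioi (0 : ℝ), Complex.exp (-lam * s) * (s : ℂ) *
          ∫ v : Fin d → ℝ, ((G v : ℝ) : ℂ)
            * Complex.exp (-(Complex.I * ∑ i, ((s * (k i : ℝ) : ℝ) : ℂ) * (v i : ℂ))) := by
  set w : Fin d → ℝ := fun i => (k i : ℝ) with hw
  let L : (Fin d → ℝ) →L[ℝ] ℝ := ∑ i, w i • ContinuousLinearMap.proj (R := ℝ) (φ := fun _ : Fin d => ℝ) i
  have hL : ∀ v, L v = ∑ i, w i * v i := by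
    intro v
    simp [L]
  have hLC : ∀ v : Fin d → ℝ, ∑ i, (k i : ℂ) * (v i : ℂ) = (L v : ℂ) := by
    intro v
    rw [hL]
    push_cast
    simp [hw]
  have hLs : ∀ (s : ℝ) (v : Fin d → ℝ),
      ∑ i, ((s * (k i : ℝ) : ℝ) : ℂ) * (v i : ℂ) = s * (L v : ℂ) := by
    intro s v
    rw [← hLC, Finset.mul_sum]
    refine Finset.sum_congr rfl fun i _ => ?_
    push_cast
    ring
  have hN : ∑ i, ((k i : ℝ)) ^ 2 = L w := by
    rw [hL]
    exact Finset.sum_congr rfl fun i _ => by simp [hw, sq]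
  have hN0 : (L w : ℂ) ≠ 0 := by
    rw [← hN]
    intro h
    have h' := Complex.ofReal_eq_zero.mp h
    rw [Finset.sum_eq_zero_iff_of_nonneg (fun i _ => sq_nonneg _)] at h'
    apply hk
    funext i
    simpa using h' i (Finset.mem_univ i)
  rw [hN]
  simp only [hLC, hLs]
  have hF := aux_F_integrable lam hlam L _ (aux_D_integrable G w)
  have e1 : ∀ v : Fin d → ℝ, ∫ s in Set.Ioi (0 : ℝ),
      ((fderiv ℝ (G : (Fin d → ℝ) → ℝ) v w : ℝ) : ℂ) * Complex.exp (-(lam + Complex.I * L v) * s)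
      = ((fderiv ℝ (G : (Fin d → ℝ) → ℝ) v w : ℝ) : ℂ) / (lam + Complex.I * L v) := by
    intro v
    rw [integral_const_mul, integral_exp_mul_complex_Ioi (by simpa using hlam)]
    simp [div_eq_mul_inv, neg_inv]
  have e2 : ∀ s : ℝ, ∫ v : Fin d → ℝ,
      ((fderiv ℝ (G : (Fin d → ℝ) → ℝ) v w : ℝ) : ℂ) * Complex.exp (-(lam + Complex.I * L v) * s)
      = (Complex.I * L w) * (Complex.exp (-lam * s) * (s : ℂ) *
        ∫ v : Fin d → ℝ, (G v : ℂ) * Complex.exp (-(Complex.I * (s * L v)))) := by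
    intro s
    have h := aux_ibp G w L s
    calc _ = ∫ v : Fin d → ℝ, Complex.exp (-lam * s) *
          (((fderiv ℝ (G : (Fin d → ℝ) → ℝ) v w : ℝ) : ℂ)
            * Complex.exp (-(Complex.I * (s * L v)))) := by
          congr 1
          funext v
          rw [show -(lam + Complex.I * L v) * s = -lam * s + -(Complex.I * (s * L v)) by ring,
            Complex.exp_add]
          ring
      _ = _ := by
          rw [integral_const_mul, h]
          ring
  have hc : Complex.I * (L w : ℂ) ≠ 0 := mul_ne_zero Complex.I_ne_zero hN0
  refine ⟨?_, ?_, ?_⟩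
  · have := hF.integral_prod_left
    simpa only [Function.uncurry, e1] using this
  · have := hF.integral_prod_right
    simp only [Function.uncurry, e2] at this
    exact (integrable_const_mul_iff (isUnit_iff_ne_zero.mpr hc) _).mp this
  · have := integral_integral_swap hF
    simp only [e1, e2] at this
    rw [this, integral_const_mul, ← mul_assoc]
    have : -(Complex.I / (L w : ℂ)) * (Complex.I * (L w : ℂ)) = 1 := by
      field_simp
      simp
    rw [this, one_mul]
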